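/- Suppose the functions H := f11·f11′ − f31·f31′ and L := f11·f31′ − f31·f11′ are both nowhere zero. Assume the structure equations (S1)–(S3) hold and ∂F/∂z_k is nowhere zero. Then for every (z0,…,z_k) ∈ ℝ^{k+1}: (i) f11·∂f12/∂z_{k−1} − f31·∂f32/∂z_{k−1} = H(z0)·∂F/∂z_k, which is nonzero; (ii) f11·∂f32/∂z_{k−1} − f31·∂f12/∂z_{k−1} = L(z0)·∂F/∂z_k, which is nonzero; (iii) ∂f22/∂z_{k−2} = f11·∂f32/∂z_{k−1} − f31·∂f12/∂z_{k−1}, so that ∂f22/∂z_{k−2} is nowhere zero; and (iv) f11′(z0)·∂f32/∂z_{k−1} − f31′(z0)·∂f12/∂z_{k−1} = 0. -/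

import Mathlib

open Real Finset

/-- Partial derivative of `f` at `z` in the `i`-th coordinate direction. -/
noncomputable def pd {n : ℕ} (f : (Fin n → ℝ) → ℝ) (z : Fin n → ℝ) (i : ℕ) : ℝ :=
  fderiv ℝ f z (fun j => if (j : ℕ) = i then 1 else 0)

/-- The `i`-th coordinate of `z` (junk value `0` out of range). -/
def zc {n : ℕ} (z : Fin n → ℝ) (i : ℕ) : ℝ :=
  if h : i < n then z ⟨i, h⟩ else 0

/-- `f` depends only on the first `m` coordinates `z_0, …, z_{m-1}`. -/
def DependsOnFirst {n : ℕ} (m : ℕ) (f : (Fin n → ℝ) → ℝ) : Prop :=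
  ∀ z w : Fin n → ℝ, (∀ j : Fin n, (j : ℕ) < m → z j = w j) → f z = f w

/-- The structure equations (S1)–(S3), required at every point `(z_0, …, z_k) ∈ ℝ^{k+1}`. -/
def StructEqs (k : ℕ) (η : ℝ) (f11 f31 : ℝ → ℝ)
    (f12 f22 f32 F : (Fin (k+1) → ℝ) → ℝ) : Prop :=
  ∀ z : Fin (k+1) → ℝ,
    deriv f11 (z 0) * F z =
      (∑ i ∈ Finset.range k, pd f12 z i * zc z (i+1)) + η * f32 z - f31 (z 0) * f22 z ∧
    (∑ i ∈ Finset.range (k-1), pd f22 z i * zc z (i+1)) =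
      f11 (z 0) * f32 z - f31 (z 0) * f12 z ∧
    deriv f31 (z 0) * F z =
      (∑ i ∈ Finset.range k, pd f32 z i * zc z (i+1)) + η * f12 z - f11 (z 0) * f22 z

/-- The Codazzi identities (C1) and (C2), required for every `(x,t) ∈ U` and every
`(z_0, …, z_{k-1})` (equivalently, every `z ∈ ℝ^{k+1}` since the data does not
depend on `z_k`).  Here `(1,0)` is the `∂/∂x` direction and `(0,1)` the `∂/∂t` one. -/
def Codazzi (k : ℕ) (η : ℝ) (f11 f31 : ℝ → ℝ) (f12 f22 f32 : (Fin (k+1) → ℝ) → ℝ)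
    (U : Set (ℝ × ℝ)) (a b c : ℝ × ℝ → ℝ) : Prop :=
  ∀ p ∈ U, ∀ z : Fin (k+1) → ℝ,
    f11 (z 0) * fderiv ℝ a p (0, 1) + η * fderiv ℝ b p (0, 1)
      - f12 z * fderiv ℝ a p (1, 0) - f22 z * fderiv ℝ b p (1, 0)
      - 2 * b p * (f11 (z 0) * f32 z - f31 (z 0) * f12 z)
      + (a p - c p) * (η * f32 z - f31 (z 0) * f22 z) = 0 ∧
    f11 (z 0) * fderiv ℝ b p (0, 1) + η * fderiv ℝ c p (0, 1)
      - f12 z * fderiv ℝ b p (1, 0) - f22 z * fderiv ℝ c p (1, 0)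
      + (a p - c p) * (f11 (z 0) * f32 z - f31 (z 0) * f12 z)
      + 2 * b p * (η * f32 z - f31 (z 0) * f22 z) = 0

/-- The `i`-th coordinate vector, as used in `pd`. -/
def coordVec (n i : ℕ) : Fin n → ℝ := fun j => if (j : ℕ) = i then 1 else 0

lemma add_smul_coordVec_apply_of_ne {n : ℕ} (z : Fin n → ℝ) (t : ℝ) {i : ℕ} {j : Fin n}
    (h : (j : ℕ) ≠ i) : (z + t • coordVec n i) j = z j := by
  simp [coordVec, h]

lemma zc_add_smul_coordVec {n : ℕ} (z : Fin n → ℝ) (t : ℝ) {i j : ℕ} (hi : i < n) :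
    zc (z + t • coordVec n i) j = zc z j + if j = i then t else 0 := by
  by_cases hj : j < n
  · simp [zc, coordVec, hj]
  · have : j ≠ i := by omega
    simp [zc, hj, this]

lemma hasDerivAt_pd {n : ℕ} {f : (Fin n → ℝ) → ℝ} {z : Fin n → ℝ}
    (hf : DifferentiableAt ℝ f z) (i : ℕ) :
    HasDerivAt (fun t : ℝ => f (z + t • coordVec n i)) (pd f z i) 0 :=
  hf.hasFDerivAt.hasLineDerivAt (coordVec n i)

namespace DependsOnFirst

variable {n m : ℕ} {f : (Fin n → ℝ) → ℝ}

lemma apply_add_smul_coordVec (hf : DependsOnFirst m f) {i : ℕ} (hi : m ≤ i)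
    (z : Fin n → ℝ) (t : ℝ) : f (z + t • coordVec n i) = f z :=
  hf _ _ fun _ hj => add_smul_coordVec_apply_of_ne z t (by omega)

lemma pd_add_smul_coordVec (hf : DependsOnFirst m f) {i : ℕ} (hi : m ≤ i)
    (z : Fin n → ℝ) (t : ℝ) (j : ℕ) : pd f (z + t • coordVec n i) j = pd f z j := by
  have h : (fun x => f (x + t • coordVec n i)) = f :=
    funext fun x => hf.apply_add_smul_coordVec hi x t
  rw [pd, pd, ← fderiv_comp_add_right, h]

/-- The total derivative of a function of the first `m + 1` coordinates is affine in the next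
coordinate. -/
lemma sum_pd_mul_zc_add_smul_coordVec (hf : DependsOnFirst (m + 1) f) (hm : m + 1 < n)
    (z : Fin n → ℝ) (t : ℝ) :
    ∑ i ∈ Finset.range (m + 1), pd f (z + t • coordVec n (m + 1)) i *
        zc (z + t • coordVec n (m + 1)) (i + 1) =
      ∑ i ∈ Finset.range (m + 1), pd f z i * zc z (i + 1) + pd f z m * t := by
  simp [hf.pd_add_smul_coordVec le_rfl, zc_add_smul_coordVec z t hm, mul_add,
    Finset.sum_add_distrib]

end DependsOnFirst

/-- In branch V (`H = f11·f11' − f31·f31'` and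
`L = f11·f31' − f31·f11'` nowhere zero), the structure equations with `∂F/∂z_k`
nowhere zero force the identities (i)–(iv) at every point; in particular
`∂f22/∂z_{k-2}` is nowhere zero. -/
theorem stmt14 (k : ℕ) (hk : 2 ≤ k) (η : ℝ) (hη : η ≠ 0)
    (f11 f31 : ℝ → ℝ) (f12 f22 f32 F : (Fin (k+1) → ℝ) → ℝ)
    (hf11 : ContDiff ℝ (⊤ : ℕ∞) f11) (hf31 : ContDiff ℝ (⊤ : ℕ∞) f31)
    (hf12 : ContDiff ℝ (⊤ : ℕ∞) f12) (hf22 : ContDiff ℝ (⊤ : ℕ∞) f22)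
    (hf32 : ContDiff ℝ (⊤ : ℕ∞) f32) (hF : ContDiff ℝ (⊤ : ℕ∞) F)
    (hdep12 : DependsOnFirst k f12) (hdep32 : DependsOnFirst k f32)
    (hdep22 : DependsOnFirst (k-1) f22)
    (hS : StructEqs k η f11 f31 f12 f22 f32 F)
    (hFk : ∀ z : Fin (k+1) → ℝ, pd F z k ≠ 0)
    (hH : ∀ z0 : ℝ, f11 z0 * deriv f11 z0 - f31 z0 * deriv f31 z0 ≠ 0)
    (hL : ∀ z0 : ℝ, f11 z0 * deriv f31 z0 - f31 z0 * deriv f11 z0 ≠ 0) :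
    ∀ z : Fin (k+1) → ℝ,
      (f11 (z 0) * pd f12 z (k-1) - f31 (z 0) * pd f32 z (k-1) =
          (f11 (z 0) * deriv f11 (z 0) - f31 (z 0) * deriv f31 (z 0)) * pd F z k ∧
        f11 (z 0) * pd f12 z (k-1) - f31 (z 0) * pd f32 z (k-1) ≠ 0) ∧
      (f11 (z 0) * pd f32 z (k-1) - f31 (z 0) * pd f12 z (k-1) =
          (f11 (z 0) * deriv f31 (z 0) - f31 (z 0) * deriv f11 (z 0)) * pd F z k ∧
        f11 (z 0) * pd f32 z (k-1) - f31 (z 0) * pd f12 z (k-1) ≠ 0) ∧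
      (pd f22 z (k-2) =
          f11 (z 0) * pd f32 z (k-1) - f31 (z 0) * pd f12 z (k-1) ∧
        pd f22 z (k-2) ≠ 0) ∧
      deriv f11 (z 0) * pd f32 z (k-1) - deriv f31 (z 0) * pd f12 z (k-1) = 0 := by
  obtain ⟨m, rfl⟩ : ∃ m, k = m + 2 := ⟨k - 2, by omega⟩
  intro z
  simp only [StructEqs, Nat.add_sub_cancel, show m + 2 - 1 = m + 1 by omega] at *
  have hd12 := hf12.differentiable (by simp) z
  have hd32 := hf32.differentiable (by simp) z
  have hdF := hasDerivAt_pd (hF.differentiable (by simp) z) (m + 2)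
  have hz : ∀ (t : ℝ) (i : ℕ), 0 < i → (z + t • coordVec (m + 2 + 1) i) 0 = z 0 :=
    fun t i hi => add_smul_coordVec_apply_of_ne z t (by simpa using hi.ne)
  have hlin : ∀ c d : ℝ, HasDerivAt (fun t : ℝ => d + c * t) c 0 := fun c d => by
    simpa using ((hasDerivAt_id (0 : ℝ)).const_mul c).const_add d
  have e1 : deriv f11 (z 0) * pd F z (m + 2) = pd f12 z (m + 1) := by
    refine (hdF.const_mul (deriv f11 (z 0))).unique
      ((hlin _ (deriv f11 (z 0) * F z)).congr_of_eventuallyEq (.of_forall fun t => ?_))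
    have h := (hS (z + t • coordVec _ (m + 2))).1
    rw [hz t _ (by omega), hdep12.sum_pd_mul_zc_add_smul_coordVec (by omega),
      hdep32.apply_add_smul_coordVec le_rfl, hdep22.apply_add_smul_coordVec (by omega)] at h
    linarith [(hS z).1]
  have e3 : deriv f31 (z 0) * pd F z (m + 2) = pd f32 z (m + 1) := by
    refine (hdF.const_mul (deriv f31 (z 0))).unique
      ((hlin _ (deriv f31 (z 0) * F z)).congr_of_eventuallyEq (.of_forall fun t => ?_))
    have h := (hS (z + t • coordVec _ (m + 2))).2.2
    rw [hz t _ (by omega), hdep32.sum_pd_mul_zc_add_smul_coordVec (by omega),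
      hdep12.apply_add_smul_coordVec le_rfl, hdep22.apply_add_smul_coordVec (by omega)] at h
    linarith [(hS z).2.2]
  have e2 : pd f22 z m = f11 (z 0) * pd f32 z (m + 1) - f31 (z 0) * pd f12 z (m + 1) := by
    refine ((hlin _ (f11 (z 0) * f32 z - f31 (z 0) * f12 z)).congr_of_eventuallyEq
      (.of_forall fun t => ?_)).unique
      (((hasDerivAt_pd hd32 (m + 1)).const_mul (f11 (z 0))).sub
        ((hasDerivAt_pd hd12 (m + 1)).const_mul (f31 (z 0))))
    have h := (hS (z + t • coordVec _ (m + 1))).2.1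
    rw [hz t _ (by omega), hdep22.sum_pd_mul_zc_add_smul_coordVec (by omega)] at h
    simp only [Pi.sub_apply]
    linarith [(hS z).2.1]
  have hi : f11 (z 0) * pd f12 z (m + 1) - f31 (z 0) * pd f32 z (m + 1) =
      (f11 (z 0) * deriv f11 (z 0) - f31 (z 0) * deriv f31 (z 0)) * pd F z (m + 2) := by
    rw [← e1, ← e3]; ring
  have hii : f11 (z 0) * pd f32 z (m + 1) - f31 (z 0) * pd f12 z (m + 1) =
      (f11 (z 0) * deriv f31 (z 0) - f31 (z 0) * deriv f11 (z 0)) * pd F z (m + 2) := by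
    rw [← e1, ← e3]; ring
  have hi' := mul_ne_zero (hH (z 0)) (hFk z)
  have hii' := mul_ne_zero (hL (z 0)) (hFk z)
  refine ⟨⟨hi, hi ▸ hi'⟩, ⟨hii, hii ▸ hii'⟩, ⟨e2, ?_⟩, ?_⟩
  · rw [e2, hii]; exact hii'
  · rw [← e1, ← e3]; ring
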